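/- arXiv:0807.2734 — 4 statements merged into one kernel-verified Lean document; each statement's English description precedes it below -/
import Mathlib

section
/- Let E be a separable Banach space and let μ be a centered Gaussian Borel probability measure on E. Then for every r > 0, μ(B(0, r)) > 0, where B(0, r) = {x ∈ E : ‖x‖ < r} is the open ball of radius r centered at the origin. -/
open MeasureTheory ProbabilityTheory

/-- A centered Gaussian Borel probability measure on a separable Banach space gives
positive mass to every open ball centered at the origin. -/
theorem gaussian_ball_pos
    {E : Type*} [NormedAddCommGroup E] [NormedSpace ℝ E] [CompleteSpace E]
    [TopologicalSpace.SeparableSpace E] [MeasurableSpace E] [BorelSpace E]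
    (μ : Measure E) [IsProbabilityMeasure μ]
    (hGauss : ∀ L : E →L[ℝ] ℝ, ∃ (m : ℝ) (v : NNReal), μ.map L = gaussianReal m v)
    (hcentered : ∀ L : E →L[ℝ] ℝ, ∫ x, L x ∂μ = 0)
    (r : ℝ) (hr : 0 < r) :
    0 < μ (Metric.ball (0 : E) r) := by
  have : SecondCountableTopology E := UniformSpace.secondCountable_of_separable E
  have : IsGaussian μ := isGaussian_of_map_eq_gaussianReal hGauss
  have hrot := IsGaussian.map_rotation_eq_self_of_forall_strongDual_eq_zero hcentered (Real.pi / 4)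
  obtain ⟨x₀, hx₀⟩ := Measure.nonempty_support (IsProbabilityMeasure.ne_zero μ)
  have hpos : 0 < μ (Metric.ball x₀ (r / 2)) :=
    (Measure.mem_support_iff_forall x₀).1 hx₀ _ (Metric.ball_mem_nhds x₀ (half_pos hr))
  have hsub : Metric.ball x₀ (r / 2) ×ˢ Metric.ball x₀ (r / 2) ⊆
      ContinuousLinearMap.rotation (E := E) (Real.pi / 4) ⁻¹'
        (Set.univ ×ˢ Metric.ball (0 : E) r) := by
    rintro ⟨x, y⟩ ⟨hx, hy⟩
    have hxy : ‖y - x‖ < r := by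
      rw [← dist_eq_norm]
      linarith [dist_triangle_right y x x₀, Metric.mem_ball.1 hx, Metric.mem_ball.1 hy]
    have hsqrt : √2 / 2 ≤ (1 : ℝ) := by
      linarith [Real.sqrt_le_sqrt (show (2 : ℝ) ≤ 2 ^ 2 by norm_num),
        Real.sqrt_sq (zero_le_two (α := ℝ))]
    have hle : ‖(√2 / 2) • (y - x)‖ ≤ ‖y - x‖ := by
      rw [norm_smul, Real.norm_of_nonneg (by positivity)]
      exact mul_le_of_le_one_left (norm_nonneg _) hsqrt
    have heq : -((√2 / 2) • x) + (√2 / 2) • y = (√2 / 2) • (y - x) := by module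
    simpa [ContinuousLinearMap.rotation_apply, heq] using hle.trans_lt hxy
  calc
    0 < μ (Metric.ball x₀ (r / 2)) * μ (Metric.ball x₀ (r / 2)) :=
      ENNReal.mul_pos hpos.ne' hpos.ne'
    _ = μ.prod μ (Metric.ball x₀ (r / 2) ×ˢ Metric.ball x₀ (r / 2)) :=
      (Measure.prod_prod _ _).symm
    _ ≤ μ.prod μ (ContinuousLinearMap.rotation (E := E) (Real.pi / 4) ⁻¹'
        (Set.univ ×ˢ Metric.ball (0 : E) r)) := measure_mono hsub
    _ = μ.prod μ (Set.univ ×ˢ Metric.ball (0 : E) r) := by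
      rw [← Measure.map_apply (by fun_prop) (MeasurableSet.univ.prod measurableSet_ball), hrot]
    _ = μ (Metric.ball (0 : E) r) := by simp
end

section
/- Let E be a separable Banach space and let μ be a centered Gaussian Borel probability measure on E which is non-degenerate in the sense that μ is not the Dirac measure at 0. Then the function ε ↦ μ(B(0, ε)) is strictly increasing on (0, ∞); equivalently, for all 0 < ε < ε' one has μ({x ∈ E : ε < ‖x‖ < ε'}) > 0, so that ε ↦ −log μ(B(0, ε)) is strictly decreasing on (0, ∞). -/
open MeasureTheory ProbabilityTheory

/-- A probability measure carried by a single point is the Dirac measure at that point. -/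
theorem eq_dirac_of_ae_eq {X : Type*} [MeasurableSpace X] {μ : Measure X}
    [IsProbabilityMeasure μ] {a : X} (h : ∀ᵐ x ∂μ, x = a) : μ = Measure.dirac a := by
  have hmap : μ.map id = μ.map fun _ => a := Measure.map_congr h
  simpa [Measure.map_const] using hmap

section RotationInvariant

variable {E : Type*} [NormedAddCommGroup E] [NormedSpace ℝ E] [SecondCountableTopology E]
  [MeasurableSpace E] [BorelSpace E] {μ : Measure E} [IsProbabilityMeasure μ]

/-- The support of a measure whose square is invariant under rotations is stable under
trigonometric combinations. -/
theorem cos_smul_add_sin_smul_mem_support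
    (hrot : ∀ θ : ℝ, (μ.prod μ).map (ContinuousLinearMap.rotation θ) = μ.prod μ) {x y : E}
    (hx : x ∈ μ.support) (hy : y ∈ μ.support) (θ : ℝ) :
    Real.cos θ • x + Real.sin θ • y ∈ μ.support := by
  rw [Measure.support_eq_forall_isOpen]
  intro U hU hUo
  have hcont : Continuous fun p : E × E => Real.cos θ • p.1 + Real.sin θ • p.2 := by fun_prop
  obtain ⟨V, hV, W, hW, hVW⟩ := mem_nhds_prod_iff.1
    ((hUo.preimage hcont).mem_nhds (show (x, y) ∈ _ from hU))
  have hμV := (Measure.mem_support_iff_forall x).1 hx V hV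
  have hμW := (Measure.mem_support_iff_forall y).1 hy W hW
  calc 0 < μ V * μ W := ENNReal.mul_pos hμV.ne' hμW.ne'
    _ = μ.prod μ (V ×ˢ W) := (Measure.prod_prod V W).symm
    _ ≤ μ.prod μ (ContinuousLinearMap.rotation θ ⁻¹' (U ×ˢ Set.univ)) :=
        measure_mono fun p hp => ⟨hVW hp, Set.mem_univ _⟩
    _ = (μ.prod μ).map (ContinuousLinearMap.rotation θ) (U ×ˢ Set.univ) :=
        (Measure.map_apply (by fun_prop) (hUo.measurableSet.prod MeasurableSet.univ)).symm
    _ = μ U := by rw [hrot, Measure.prod_prod, measure_univ, mul_one]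

theorem zero_mem_support_of_map_rotation_eq_self
    (hrot : ∀ θ : ℝ, (μ.prod μ).map (ContinuousLinearMap.rotation θ) = μ.prod μ) :
    (0 : E) ∈ μ.support := by
  obtain ⟨x, hx⟩ := Measure.nonempty_support (IsProbabilityMeasure.ne_zero μ)
  have hneg : -x ∈ μ.support := by
    simpa using cos_smul_add_sin_smul_mem_support hrot hx hx Real.pi
  simpa using cos_smul_add_sin_smul_mem_support hrot hx hneg (Real.pi / 4)

theorem smul_mem_support_of_map_rotation_eq_self
    (hrot : ∀ θ : ℝ, (μ.prod μ).map (ContinuousLinearMap.rotation θ) = μ.prod μ) {x : E}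
    (hx : x ∈ μ.support) (t : ℝ) : t • x ∈ μ.support := by
  have hpow : ∀ n : ℕ, (√2 ^ n) • x ∈ μ.support := by
    intro n
    induction n with
    | zero => simpa using hx
    | succ n ih =>
      have h := cos_smul_add_sin_smul_mem_support hrot ih ih (Real.pi / 4)
      rwa [← add_smul, Real.cos_pi_div_four, Real.sin_pi_div_four, add_halves, smul_smul,
        ← pow_succ'] at h
  obtain ⟨n, hn⟩ := pow_unbounded_of_one_lt |t| Real.one_lt_sqrt_two
  have hpos : 0 < √2 ^ n := by positivity
  obtain ⟨h₁, h₂⟩ := abs_le.1 hn.le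
  have h := cos_smul_add_sin_smul_mem_support hrot (hpow n)
    (zero_mem_support_of_map_rotation_eq_self hrot) (Real.arccos (t / √2 ^ n))
  rwa [Real.cos_arccos (by rw [le_div_iff₀ hpos]; linarith) (by rwa [div_le_one hpos]),
    smul_zero, add_zero, smul_smul, div_mul_cancel₀ _ hpos.ne'] at h

theorem measure_annulus_pos_of_map_rotation_eq_self
    (hrot : ∀ θ : ℝ, (μ.prod μ).map (ContinuousLinearMap.rotation θ) = μ.prod μ)
    (hμ : μ ≠ Measure.dirac 0) {a b : ℝ} (ha : 0 ≤ a) (hab : a < b) :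
    0 < μ {x : E | a < ‖x‖ ∧ ‖x‖ < b} := by
  obtain ⟨x, hx, hx0⟩ : ∃ x ∈ μ.support, x ≠ 0 := by
    contrapose! hμ
    exact eq_dirac_of_ae_eq (Filter.mem_of_superset Measure.support_mem_ae hμ)
  have hb : 0 < b := ha.trans_lt hab
  have hnorm : ‖((a + b) / 2 / ‖x‖) • x‖ = (a + b) / 2 := by
    rw [norm_smul, Real.norm_of_nonneg (by positivity), div_mul_cancel₀ _ (norm_ne_zero_iff.2 hx0)]
  have hopen : IsOpen {x : E | a < ‖x‖ ∧ ‖x‖ < b} :=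
    (isOpen_lt continuous_const continuous_norm).inter (isOpen_lt continuous_norm continuous_const)
  refine (Measure.mem_support_iff_forall _).1
    (smul_mem_support_of_map_rotation_eq_self hrot hx ((a + b) / 2 / ‖x‖)) _ (hopen.mem_nhds ?_)
  constructor <;> rw [hnorm] <;> linarith

end RotationInvariant

/-- For a non-degenerate centered Gaussian measure on a separable Banach space,
the small-ball probability `ε ↦ μ(B(0,ε))` is strictly increasing on `(0,∞)`;
equivalently every annulus `{ε < ‖x‖ < ε'}` has positive mass, so that
`ε ↦ -log μ(B(0,ε))` is strictly decreasing on `(0,∞)`. -/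
theorem gaussian_small_ball_strictMono
    {E : Type*} [NormedAddCommGroup E] [NormedSpace ℝ E] [CompleteSpace E]
    [TopologicalSpace.SeparableSpace E] [MeasurableSpace E] [BorelSpace E]
    (μ : Measure E) [IsProbabilityMeasure μ]
    (hGauss : ∀ L : E →L[ℝ] ℝ, ∃ (m : ℝ) (v : NNReal), μ.map L = gaussianReal m v)
    (hcentered : ∀ L : E →L[ℝ] ℝ, ∫ x, L x ∂μ = 0)
    (hnondeg : μ ≠ Measure.dirac (0 : E)) :
    StrictMonoOn (fun ε => μ (Metric.ball (0 : E) ε)) (Set.Ioi 0) ∧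
      (∀ ε ε' : ℝ, 0 < ε → ε < ε' → 0 < μ {x : E | ε < ‖x‖ ∧ ‖x‖ < ε'}) ∧
      StrictAntiOn (fun ε => -Real.log (μ (Metric.ball (0 : E) ε)).toReal)
        (Set.Ioi 0) := by
  have := UniformSpace.secondCountable_of_separable E
  have := isGaussian_of_map_eq_gaussianReal hGauss
  have hrot : ∀ θ : ℝ, (μ.prod μ).map (ContinuousLinearMap.rotation θ) = μ.prod μ :=
    IsGaussian.map_rotation_eq_self_of_forall_strongDual_eq_zero hcentered
  have hannulus : ∀ ε ε' : ℝ, 0 < ε → ε < ε' → 0 < μ {x : E | ε < ‖x‖ ∧ ‖x‖ < ε'} :=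
    fun ε ε' hε h => measure_annulus_pos_of_map_rotation_eq_self hrot hnondeg hε.le h
  have hball : ∀ ε : ℝ, 0 < ε → 0 < μ (Metric.ball (0 : E) ε) := fun ε hε =>
    (Measure.mem_support_iff_forall _).1 (zero_mem_support_of_map_rotation_eq_self hrot) _
      (Metric.ball_mem_nhds _ hε)
  have hmono : StrictMonoOn (fun ε => μ (Metric.ball (0 : E) ε)) (Set.Ioi 0) := by
    intro ε hε ε' _ h
    have hdisj : Disjoint (Metric.ball (0 : E) ε) {x : E | ε < ‖x‖ ∧ ‖x‖ < ε'} :=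
      Set.disjoint_left.2 fun x hx hx' => (mem_ball_zero_iff.1 hx).not_gt hx'.1
    calc μ (Metric.ball (0 : E) ε)
        < μ (Metric.ball (0 : E) ε) + μ {x : E | ε < ‖x‖ ∧ ‖x‖ < ε'} :=
          ENNReal.lt_add_right (measure_ne_top _ _) (hannulus ε ε' hε h).ne'
      _ = μ (Metric.ball (0 : E) ε ∪ {x : E | ε < ‖x‖ ∧ ‖x‖ < ε'}) :=
          (measure_union' hdisj Metric.isOpen_ball.measurableSet).symm
      _ ≤ μ (Metric.ball (0 : E) ε') := measure_mono <| Set.union_subset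
          (Metric.ball_subset_ball h.le) fun x hx => mem_ball_zero_iff.2 hx.2
  refine ⟨hmono, hannulus, fun ε hε ε' hε' h => neg_lt_neg (Real.log_lt_log ?_ ?_)⟩
  · exact ENNReal.toReal_pos (hball ε hε).ne' (measure_ne_top _ _)
  · exact ENNReal.toReal_strict_mono (measure_ne_top _ _) (hmono hε hε' h)
end

section
/- Let E be a separable Banach space and let μ be a centered Gaussian Borel probability measure on E. Then the function ε ↦ −log μ(B(0, ε)) is convex on (0, ∞), where B(0, ε) = {x ∈ E : ‖x‖ < ε}. -/
open MeasureTheory ProbabilityTheory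
open scoped ENNReal Pointwise

lemma volume_add_le_of_isCompact {K L C : Set ℝ} (hK : IsCompact K) (hL : IsCompact L)
    (hKne : K.Nonempty) (hLne : L.Nonempty) {s t : ℝ} (hs : 0 < s) (ht : 0 < t)
    (h : ∀ x ∈ K, ∀ y ∈ L, s * x + t * y ∈ C) :
    ENNReal.ofReal s * volume K + ENNReal.ofReal t * volume L ≤ volume C := by
  set M := sSup K
  set m := sInf L
  have hM : M ∈ K := hK.sSup_mem hKne
  have hm : m ∈ L := hL.sInf_mem hLne
  set P := (fun x => x + t * m) '' (s • K)
  set Q := (fun x => s * M + x) '' (t • L)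
  have hP : volume P = ENNReal.ofReal s * volume K := by
    simp [P, Set.image_add_right, measure_preimage_add_right, Measure.addHaar_smul, abs_of_pos hs]
  have hQ : volume Q = ENNReal.ofReal t * volume L := by
    simp [Q, Set.image_add_left, measure_preimage_add, Measure.addHaar_smul, abs_of_pos ht]
  have hQm : MeasurableSet Q :=
    ((hL.smul t).image (by fun_prop : Continuous fun x => s * M + x)).measurableSet
  have hPQ : P ∩ Q ⊆ {s * M + t * m} := by
    rintro z ⟨⟨_, ⟨x, hx, rfl⟩, hxz⟩, ⟨_, ⟨y, hy, rfl⟩, hyz⟩⟩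
    have h1 : s * x ≤ s * M := mul_le_mul_of_nonneg_left (le_csSup hK.bddAbove hx) hs.le
    have h2 : t * m ≤ t * y := mul_le_mul_of_nonneg_left (csInf_le hL.bddBelow hy) ht.le
    simp only [smul_eq_mul] at hxz hyz
    simp only [Set.mem_singleton_iff]
    linarith
  rw [← hP, ← hQ, ← measure_union₀ hQm.nullMeasurableSet
    (measure_mono_null hPQ Real.volume_singleton)]
  refine measure_mono (Set.union_subset ?_ ?_)
  · rintro _ ⟨_, ⟨x, hx, rfl⟩, rfl⟩
    exact h x hx m hm
  · rintro _ ⟨_, ⟨y, hy, rfl⟩, rfl⟩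
    exact h M hM y hy

/-- The one-dimensional Brunn–Minkowski inequality. -/
lemma volume_add_le {A B C : Set ℝ} (hA : MeasurableSet A) (hB : MeasurableSet B)
    (hAne : A.Nonempty) (hBne : B.Nonempty) {s t : ℝ} (hs : 0 < s) (ht : 0 < t)
    (h : ∀ x ∈ A, ∀ y ∈ B, s * x + t * y ∈ C) :
    ENNReal.ofReal s * volume A + ENNReal.ofReal t * volume B ≤ volume C := by
  obtain ⟨a, ha⟩ := hAne
  obtain ⟨b, hb⟩ := hBne
  simp only [hA.measure_eq_iSup_isCompact, hB.measure_eq_iSup_isCompact, ENNReal.mul_iSup,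
    iSup_and']
  refine ENNReal.biSup_add_biSup_le' ⟨∅, by simp⟩ ⟨∅, by simp⟩ fun K hK L hL => ?_
  have hsub {S S' : Set ℝ} {c : ℝ} (hS : S ⊆ S') (hc : c ∈ S') : insert c S ⊆ S' :=
    Set.insert_subset hc hS
  refine le_trans ?_ (volume_add_le_of_isCompact (hK.2.insert a) (hL.2.insert b)
    (Set.insert_nonempty _ _) (Set.insert_nonempty _ _) hs ht
    fun x hx y hy => h x (hsub hK.1 ha hx) y (hsub hL.1 hb hy))
  gcongr <;> exact Set.subset_insert _ _

lemma rpow_mul_rpow_le_add {s t : ℝ} (hs : 0 < s) (ht : 0 < t) (hst : s + t = 1) (a b : ℝ≥0∞) :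
    a ^ s * b ^ t ≤ ENNReal.ofReal s * a + ENNReal.ofReal t * b := by
  rcases eq_or_ne a ∞ with rfl | ha
  · simp [ENNReal.mul_top, hs]
  rcases eq_or_ne b ∞ with rfl | hb
  · simp [ENNReal.mul_top, ht]
  lift a to NNReal using ha
  lift b to NNReal using hb
  have := NNReal.geom_mean_le_arith_mean2_weighted s.toNNReal t.toNNReal a b
    (by rw [← Real.toNNReal_add hs.le ht.le, hst, Real.toNNReal_one])
  rw [Real.coe_toNNReal s hs.le, Real.coe_toNNReal t ht.le] at this
  rw [← ENNReal.coe_rpow_of_nonneg _ hs.le, ← ENNReal.coe_rpow_of_nonneg _ ht.le]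
  simp only [ENNReal.ofReal]
  exact_mod_cast this

lemma lintegral_eq_lintegral_Ioo_volume {f : ℝ → ℝ≥0∞} (hf : Measurable f) (h1 : ∀ x, f x ≤ 1) :
    ∫⁻ x, f x = ∫⁻ r in Set.Ioo (0 : ℝ) 1, volume {x | ENNReal.ofReal r < f x} := by
  have hne : ∀ x, f x ≠ ∞ := fun x => ne_top_of_le_ne_top ENNReal.one_ne_top (h1 x)
  have key := lintegral_eq_lintegral_meas_lt volume (f := fun x => (f x).toReal)
    (.of_forall fun x => ENNReal.toReal_nonneg) hf.ennreal_toReal.aemeasurable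
  simp only [ENNReal.ofReal_toReal (hne _)] at key
  rw [key, ← Set.Ioo_union_Ici_eq_Ioi (zero_lt_one' ℝ),
    lintegral_union measurableSet_Ici (Set.disjoint_left.2 fun x hx hx' => hx.2.not_ge hx')]
  have h0 : ∫⁻ r in Set.Ici (1 : ℝ), volume {x | r < (f x).toReal} = 0 := by
    rw [setLIntegral_congr_fun (g := fun _ => 0) measurableSet_Ici]
    · simp
    · intro r hr
      have : {x | r < (f x).toReal} = ∅ := by
        ext x
        have : (f x).toReal ≤ 1 := ENNReal.toReal_mono ENNReal.one_ne_top (h1 x)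
        simpa using this.trans hr
      simp [this]
  rw [h0, add_zero]
  refine setLIntegral_congr_fun measurableSet_Ioo fun r hr => ?_
  simp [ENNReal.ofReal_lt_iff_lt_toReal hr.1.le (hne _)]

lemma lintegral_add_le_of_iSup_eq_one {s t : ℝ} (hs : 0 < s) (ht : 0 < t) (hst : s + t = 1)
    {f g h : ℝ → ℝ≥0∞} (hf : Measurable f) (hg : Measurable g) (hh : Measurable h)
    (hf1 : ⨆ x, f x = 1) (hg1 : ⨆ x, g x = 1)
    (hfgh : ∀ x y, f x ^ s * g y ^ t ≤ h (s * x + t * y)) :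
    ENNReal.ofReal s * (∫⁻ x, f x) + ENNReal.ofReal t * (∫⁻ x, g x) ≤ ∫⁻ x, h x := by
  have hfle : ∀ x, f x ≤ 1 := fun x => hf1 ▸ le_iSup f x
  have hgle : ∀ x, g x ≤ 1 := fun x => hg1 ▸ le_iSup g x
  refine le_trans ?_ (lintegral_mono (fun x => min_le_left (h x) 1))
  rw [lintegral_eq_lintegral_Ioo_volume hf hfle, lintegral_eq_lintegral_Ioo_volume hg hgle,
    lintegral_eq_lintegral_Ioo_volume (hh.min measurable_const) (fun x => min_le_right _ _)]
  have hmeas (u : ℝ → ℝ≥0∞) : Measurable fun r : ℝ => volume {x | ENNReal.ofReal r < u x} :=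
    Antitone.measurable fun r r' hr => measure_mono fun x hx =>
      (ENNReal.ofReal_le_ofReal hr).trans_lt hx
  rw [← lintegral_const_mul _ (hmeas f), ← lintegral_const_mul _ (hmeas g),
    ← lintegral_add_left ((hmeas f).const_mul _)]
  refine setLIntegral_mono' measurableSet_Ioo fun r hr => ?_
  have hr1 : ENNReal.ofReal r < 1 := by simpa using hr.2
  have hfr : ∃ x, ENNReal.ofReal r < f x := lt_iSup_iff.1 (hf1 ▸ hr1)
  have hgr : ∃ x, ENNReal.ofReal r < g x := lt_iSup_iff.1 (hg1 ▸ hr1)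
  refine volume_add_le (measurableSet_lt measurable_const hf)
    (measurableSet_lt measurable_const hg) hfr hgr hs ht fun x hx y hy => ?_
  refine lt_min (lt_of_lt_of_le ?_ (hfgh x y)) hr1
  calc ENNReal.ofReal r = ENNReal.ofReal r ^ s * ENNReal.ofReal r ^ t := by
        rw [← ENNReal.rpow_add_of_nonneg _ _ hs.le ht.le, hst, ENNReal.rpow_one]
    _ < f x ^ s * g y ^ t :=
        ENNReal.mul_lt_mul (ENNReal.rpow_lt_rpow hx hs) (ENNReal.rpow_lt_rpow hy ht)

/-- A measure is *log-concave* with weights `s, t` if it satisfies the conclusion of the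
Prékopa–Leindler inequality for these weights. -/
def PrekopaLeindler {E : Type*} [AddCommGroup E] [Module ℝ E] [MeasurableSpace E] (s t : ℝ)
    (ν : Measure E) : Prop :=
  ∀ f g h : E → ℝ≥0∞, Measurable f → Measurable g → Measurable h →
    (∀ x y, f x ^ s * g y ^ t ≤ h (s • x + t • y)) →
    (∫⁻ x, f x ∂ν) ^ s * (∫⁻ x, g x ∂ν) ^ t ≤ ∫⁻ x, h x ∂ν

lemma lintegral_rpow_mul_le_of_iSup_ne_top {s t : ℝ} (hs : 0 < s) (ht : 0 < t) (hst : s + t = 1)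
    {f g h : ℝ → ℝ≥0∞} (hf : Measurable f) (hg : Measurable g) (hh : Measurable h)
    (hf1 : ⨆ x, f x ≠ ∞) (hg1 : ⨆ x, g x ≠ ∞)
    (hfgh : ∀ x y, f x ^ s * g y ^ t ≤ h (s * x + t * y)) :
    (∫⁻ x, f x) ^ s * (∫⁻ x, g x) ^ t ≤ ∫⁻ x, h x := by
  set a := ⨆ x, f x with ha
  set b := ⨆ x, g x with hb
  rcases eq_or_ne a 0 with ha0 | ha0
  · have : ∀ x, f x = 0 := by simpa [ha] using ha0
    simp [this, hs]
  rcases eq_or_ne b 0 with hb0 | hb0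
  · have : ∀ x, g x = 0 := by simpa [hb] using hb0
    simp [this, ht]
  have hs0 := hs.le
  have ht0 := ht.le
  set c := (a⁻¹) ^ s * (b⁻¹) ^ t with hc
  have hc0 : c ≠ 0 := by simp [hc, hs, ht, hs0, ht0, hf1, hg1]
  have hct : c ≠ ∞ := by
    refine ENNReal.mul_ne_top ?_ ?_ <;> refine ENNReal.rpow_ne_top_of_nonneg (by assumption) ?_ <;>
      simpa
  have key := lintegral_add_le_of_iSup_eq_one hs ht hst (hf.const_mul a⁻¹) (hg.const_mul b⁻¹)
    (hh.const_mul c) (by rw [← ENNReal.mul_iSup, ENNReal.inv_mul_cancel ha0 hf1])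
    (by rw [← ENNReal.mul_iSup, ENNReal.inv_mul_cancel hb0 hg1]) (fun x y => by
      rw [ENNReal.mul_rpow_of_nonneg _ _ hs0, ENNReal.mul_rpow_of_nonneg _ _ ht0,
        mul_mul_mul_comm]
      gcongr
      exact hfgh x y)
  replace key := (rpow_mul_rpow_le_add hs ht hst _ _).trans key
  rw [lintegral_const_mul _ hf, lintegral_const_mul _ hg, lintegral_const_mul _ hh,
    ENNReal.mul_rpow_of_nonneg _ _ hs0, ENNReal.mul_rpow_of_nonneg _ _ ht0,
    mul_mul_mul_comm] at key
  exact (ENNReal.mul_le_mul_iff_right hc0 hct).1 key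

/-- The Prékopa–Leindler inequality on the real line. -/
lemma prekopaLeindler_volume_real {s t : ℝ} (hs : 0 < s) (ht : 0 < t) (hst : s + t = 1) :
    PrekopaLeindler s t (volume : Measure ℝ) := by
  intro f g h hf hg hh hfgh
  rcases eq_or_ne (∫⁻ x, f x) 0 with hf0 | hf0
  · simp [hf0, hs]
  rcases eq_or_ne (∫⁻ x, g x) 0 with hg0 | hg0
  · simp [hg0, ht]
  have lim {u : ℝ → ℝ≥0∞} (hu : Measurable u) :
      Filter.Tendsto (fun n : ℕ => ∫⁻ x, min (u x) n) Filter.atTop (nhds (∫⁻ x, u x)) := by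
    refine lintegral_tendsto_of_tendsto_of_monotone
      (fun n => (hu.min measurable_const).aemeasurable)
      (.of_forall fun x n m hnm => min_le_min_left _ (by exact_mod_cast hnm))
      (.of_forall fun x => ?_)
    simpa using (tendsto_const_nhds (x := u x)).min ENNReal.tendsto_nat_nhds_top
  have bdd (u : ℝ → ℝ≥0∞) (n : ℕ) : ⨆ x, min (u x) n ≠ ∞ :=
    ne_top_of_le_ne_top (ENNReal.natCast_ne_top n) (iSup_le fun x => min_le_right _ _)
  refine le_of_tendsto (ENNReal.Tendsto.mul ((lim hf).ennrpow_const s) (Or.inl ?_)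
    ((lim hg).ennrpow_const t) (Or.inl ?_)) (.of_forall fun n =>
    lintegral_rpow_mul_le_of_iSup_ne_top hs ht hst (hf.min measurable_const)
      (hg.min measurable_const) hh (bdd f n) (bdd g n) fun x y => le_trans ?_ (hfgh x y))
  · simp [ENNReal.rpow_eq_zero_iff, hf0, hs.not_gt]
  · simp [ENNReal.rpow_eq_zero_iff, hg0, ht.not_gt]
  · gcongr <;> exact min_le_left _ _

namespace PrekopaLeindler

variable {E F : Type*} [AddCommGroup E] [Module ℝ E] [MeasurableSpace E]
  [AddCommGroup F] [Module ℝ F] [MeasurableSpace F] {s t : ℝ}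

lemma withDensity {ν : Measure E} (hν : PrekopaLeindler s t ν) (hs : 0 ≤ s) (ht : 0 ≤ t)
    {φ : E → ℝ≥0∞} (hφ : Measurable φ) (hφc : ∀ x y, φ x ^ s * φ y ^ t ≤ φ (s • x + t • y)) :
    PrekopaLeindler s t (ν.withDensity φ) := by
  intro f g h hf hg hh hfgh
  simp only [lintegral_withDensity_eq_lintegral_mul _ hφ hf,
    lintegral_withDensity_eq_lintegral_mul _ hφ hg, lintegral_withDensity_eq_lintegral_mul _ hφ hh]
  refine hν _ _ _ (hφ.mul hf) (hφ.mul hg) (hφ.mul hh) fun x y => ?_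
  simp only [Pi.mul_apply]
  rw [ENNReal.mul_rpow_of_nonneg _ _ hs, ENNReal.mul_rpow_of_nonneg _ _ ht, mul_mul_mul_comm]
  exact mul_le_mul' (hφc x y) (hfgh x y)

lemma prod {ν : Measure E} {ρ : Measure F} [SFinite ρ] (hν : PrekopaLeindler s t ν)
    (hρ : PrekopaLeindler s t ρ) : PrekopaLeindler s t (ν.prod ρ) := by
  intro f g h hf hg hh hfgh
  rw [lintegral_prod _ hf.aemeasurable, lintegral_prod _ hg.aemeasurable,
    lintegral_prod _ hh.aemeasurable]
  exact hν _ _ _ hf.lintegral_prod_right' hg.lintegral_prod_right' hh.lintegral_prod_right'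
    fun x y => hρ _ _ _ (hf.comp measurable_prodMk_left) (hg.comp measurable_prodMk_left)
      (hh.comp measurable_prodMk_left) fun x' y' => hfgh (x, x') (y, y')

lemma map {ν : Measure E} (hν : PrekopaLeindler s t ν) {T : E → F} (hT : Measurable T)
    (hTl : ∀ x y, T (s • x + t • y) = s • T x + t • T y) : PrekopaLeindler s t (ν.map T) := by
  intro f g h hf hg hh hfgh
  rw [lintegral_map hf hT, lintegral_map hg hT, lintegral_map hh hT]
  exact hν _ _ _ (hf.comp hT) (hg.comp hT) (hh.comp hT) fun x y => by
    simpa [hTl] using hfgh (T x) (T y)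

lemma pi_fin {n : ℕ} {ν : Fin n → Measure ℝ} [∀ i, SigmaFinite (ν i)]
    (hν : ∀ i, PrekopaLeindler s t (ν i)) : PrekopaLeindler s t (Measure.pi ν) := by
  induction n with
  | zero =>
    intro f g h hf hg hh hfgh
    rw [Measure.pi_of_empty, lintegral_dirac' _ hf, lintegral_dirac' _ hg, lintegral_dirac' _ hh]
    convert! hfgh _ _
  | succ n ih =>
    rw [← ((measurePreserving_piFinSuccAbove ν 0).symm).map_eq]
    refine ((hν 0).prod (ih fun i => hν _)).map (MeasurableEquiv.measurable _) fun x y => ?_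
    ext i
    refine Fin.cases ?_ (fun j => ?_) i <;> simp [MeasurableEquiv.piFinSuccAbove]

lemma measure_rpow_mul_le {ν : Measure E} (hν : PrekopaLeindler s t ν) (hs : 0 < s) (ht : 0 < t)
    {A B C : Set E} (hA : MeasurableSet A) (hB : MeasurableSet B) (hC : MeasurableSet C)
    (h : ∀ x ∈ A, ∀ y ∈ B, s • x + t • y ∈ C) : ν A ^ s * ν B ^ t ≤ ν C := by
  have := hν (A.indicator 1) (B.indicator 1) (C.indicator 1) (measurable_one.indicator hA)
    (measurable_one.indicator hB) (measurable_one.indicator hC) fun x y => by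
      by_cases hx : x ∈ A
      · by_cases hy : y ∈ B
        · simp [hx, hy, h x hx y hy]
        · simp [hy, ht]
      · simp [hx, hs]
  simpa [lintegral_indicator_one, hA, hB, hC] using this

end PrekopaLeindler

lemma prekopaLeindler_gaussianReal {s t : ℝ} (hs : 0 < s) (ht : 0 < t) (hst : s + t = 1) :
    PrekopaLeindler s t (gaussianReal 0 1) := by
  rw [gaussianReal_of_var_ne_zero _ one_ne_zero]
  refine (prekopaLeindler_volume_real hs ht hst).withDensity hs.le ht.le
    (measurable_gaussianPDF _ _) fun x y => ?_
  have pos (z : ℝ) : 0 < gaussianPDFReal 0 1 z := gaussianPDFReal_pos _ _ _ one_ne_zero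
  simp only [gaussianPDF]
  rw [ENNReal.ofReal_rpow_of_pos (pos x), ENNReal.ofReal_rpow_of_pos (pos y),
    ← ENNReal.ofReal_mul (by positivity [pos x])]
  refine ENNReal.ofReal_le_ofReal ?_
  simp only [gaussianPDFReal, NNReal.coe_one, sub_zero, mul_one, smul_eq_mul]
  set c := (√(2 * Real.pi))⁻¹
  have hc : 0 < c := by positivity
  rw [Real.mul_rpow hc.le (Real.exp_pos _).le, Real.mul_rpow hc.le (Real.exp_pos _).le,
    mul_mul_mul_comm, ← Real.rpow_add hc, hst, Real.rpow_one, ← Real.exp_mul, ← Real.exp_mul,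
    ← Real.exp_add]
  gcongr
  obtain rfl : t = 1 - s := by linarith
  nlinarith [mul_nonneg (mul_pos hs ht).le (sq_nonneg (x - y))]

lemma prekopaLeindler_stdGaussian {ι : Type*} [Fintype ι] {s t : ℝ} (hs : 0 < s) (ht : 0 < t)
    (hst : s + t = 1) : PrekopaLeindler s t (stdGaussian (EuclideanSpace ℝ ι)) := by
  refine PrekopaLeindler.map (.pi_fin fun _ => prekopaLeindler_gaussianReal hs ht hst)
    (by fun_prop) fun x y => ?_
  simp [add_smul, Finset.sum_add_distrib, Finset.smul_sum, mul_smul]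

/-- A centered Gaussian measure on a Euclidean space is a linear image of the standard one. -/
lemma eq_multivariateGaussian {ι : Type*} [Fintype ι] [DecidableEq ι]
    (ν : Measure (EuclideanSpace ℝ ι)) [IsGaussian ν] (hν : ν[id] = 0) :
    ∃ S : Matrix ι ι ℝ, ν = multivariateGaussian 0 S := by
  set B := (covarianceBilin ν).toBilinForm
  set b := (EuclideanSpace.basisFun ι ℝ).toBasis
  have hS (x y : EuclideanSpace ℝ ι) :
      covarianceBilin ν x y = x.ofLp ⬝ᵥ (LinearMap.toMatrix₂ b b B).mulVec y.ofLp :=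
    LinearMap.BilinForm.apply_eq_dotProduct_toMatrix_mulVec b B x y
  have hpos : (LinearMap.toMatrix₂ b b B).PosSemidef := by
    refine .of_dotProduct_mulVec_nonneg ?_ fun x => ?_
    · ext i j
      simp [B, covarianceBilin_comm (b i) (b j)]
    · have := hS (WithLp.toLp 2 x) (WithLp.toLp 2 x)
      simp only [star_trivial]
      exact this ▸ covarianceBilin_self_nonneg _
  refine ⟨LinearMap.toMatrix₂ b b B, IsGaussian.ext (by rw [hν, integral_id_multivariateGaussian']) ?_⟩
  ext x y
  rw [covarianceBilin_multivariateGaussian hpos, hS]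

lemma prekopaLeindler_of_isGaussian {ι : Type*} [Fintype ι] (ν : Measure (EuclideanSpace ℝ ι))
    [IsGaussian ν] (hν : ν[id] = 0) {s t : ℝ} (hs : 0 < s) (ht : 0 < t) (hst : s + t = 1) :
    PrekopaLeindler s t ν := by
  classical
  obtain ⟨S, rfl⟩ := eq_multivariateGaussian ν hν
  refine (prekopaLeindler_stdGaussian hs ht hst).map (by fun_prop) fun x y => ?_
  simp

/-- The norm of a separable space is the supremum of countably many continuous functionals. -/
lemma exists_seq_dual_norm_le_iff (E : Type*) [NormedAddCommGroup E] [NormedSpace ℝ E]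
    [TopologicalSpace.SeparableSpace E] :
    ∃ L : ℕ → E →L[ℝ] ℝ, ∀ x r, ‖x‖ ≤ r ↔ ∀ n, |L n x| ≤ r := by
  choose L hL1 hL2 using fun n => exists_dual_vector'' ℝ (TopologicalSpace.denseSeq E n)
  refine ⟨L, fun x r => ⟨fun h n => ?_, fun h => le_of_forall_pos_le_add fun ε hε => ?_⟩⟩
  · exact (((L n).le_of_opNorm_le (hL1 n) x).trans_eq (one_mul _)).trans h
  · obtain ⟨n, hn⟩ := (TopologicalSpace.denseRange_denseSeq E).exists_dist_lt x (half_pos hε)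
    set y := TopologicalSpace.denseSeq E n
    rw [dist_eq_norm] at hn
    have h1 : ‖x‖ ≤ ‖y‖ + ‖x - y‖ := by simpa using norm_add_le y (x - y)
    have h2 : L n y = ‖y‖ := hL2 n
    have h3 : |L n (x - y)| ≤ ‖x - y‖ :=
      ((L n).le_of_opNorm_le (hL1 n) (x - y)).trans_eq (one_mul _)
    have h4 := h n
    rw [map_sub] at h3
    grind

section Ball

variable {E : Type*} [NormedAddCommGroup E] [NormedSpace ℝ E] [CompleteSpace E]
  [SecondCountableTopology E] [MeasurableSpace E] [BorelSpace E] {μ : Measure E} [IsGaussian μ]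

lemma measure_forall_abs_le_rpow_mul_le (hμ : ∀ L : E →L[ℝ] ℝ, ∫ x, L x ∂μ = 0) {n : ℕ}
    (L : Fin n → E →L[ℝ] ℝ) {s t : ℝ} (hs : 0 < s) (ht : 0 < t) (hst : s + t = 1) (a b : ℝ) :
    μ {x | ∀ i, |L i x| ≤ a} ^ s * μ {x | ∀ i, |L i x| ≤ b} ^ t ≤
      μ {x | ∀ i, |L i x| ≤ s * a + t * b} := by
  let T : E →L[ℝ] EuclideanSpace ℝ (Fin n) :=
    (EuclideanSpace.equiv (Fin n) ℝ).symm.toContinuousLinearMap ∘L ContinuousLinearMap.pi L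
  have hT : (μ.map T)[id] = 0 := by
    simp only [id_eq]
    rw [ContinuousLinearMap.integral_id_map IsGaussian.integrable_id]
    have : ∫ x, x ∂μ = 0 := (SeparatingDual.eq_zero_iff_forall_dual_eq_zero (R := ℝ) _).2 fun l => by
      rw [← l.integral_comp_id_comm IsGaussian.integrable_id, hμ]
    simp [this]
  have hmeas (r : ℝ) : MeasurableSet {y : EuclideanSpace ℝ (Fin n) | ∀ i, |y i| ≤ r} := by
    simp only [Set.ofPred_forall]
    exact .iInter fun i => measurableSet_le (by fun_prop) measurable_const
  have key := (prekopaLeindler_of_isGaussian (μ.map T) hT hs ht hst).measure_rpow_mul_le hs ht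
    (hmeas a) (hmeas b) (hmeas (s * a + t * b)) fun x hx y hy i => by
      rw [PiLp.add_apply, PiLp.smul_apply, PiLp.smul_apply, smul_eq_mul, smul_eq_mul]
      refine (abs_add_le _ _).trans ?_
      rw [abs_mul, abs_mul, abs_of_pos hs, abs_of_pos ht]
      gcongr
      exacts [hx i, hy i]
  simp only [Measure.map_apply T.measurable (hmeas _)] at key
  exact key

lemma measure_closedBall_rpow_mul_le (hμ : ∀ L : E →L[ℝ] ℝ, ∫ x, L x ∂μ = 0)
    {s t : ℝ} (hs : 0 < s) (ht : 0 < t) (hst : s + t = 1) (a b : ℝ) :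
    μ (Metric.closedBall 0 a) ^ s * μ (Metric.closedBall 0 b) ^ t ≤
      μ (Metric.closedBall 0 (s * a + t * b)) := by
  obtain ⟨L, hL⟩ := exists_seq_dual_norm_le_iff E
  let A (r : ℝ) (n : ℕ) : Set E := {x | ∀ i : Fin n, |L i x| ≤ r}
  have hA (r : ℝ) (n : ℕ) : Metric.closedBall 0 r ⊆ A r n := fun x hx i =>
    (hL x r).1 (mem_closedBall_zero_iff.1 hx) i
  have hmeas (r : ℝ) (n : ℕ) : MeasurableSet (A r n) := by
    simp only [A, Set.ofPred_forall]
    exact .iInter fun i => measurableSet_le (by fun_prop) measurable_const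
  have hanti (r : ℝ) : Antitone (A r) := fun n m hnm x hx i => hx (i.castLE hnm)
  have hInter (r : ℝ) : ⋂ n, A r n = Metric.closedBall 0 r := by
    refine (Set.subset_iInter (hA r)).antisymm' fun x hx => ?_
    rw [mem_closedBall_zero_iff, hL]
    exact fun n => Set.mem_iInter.1 hx (n + 1) ⟨n, n.lt_succ_self⟩
  have hlim := tendsto_measure_iInter_atTop (μ := μ)
    (fun n => (hmeas (s * a + t * b) n).nullMeasurableSet) (hanti _) ⟨0, measure_ne_top _ _⟩
  rw [hInter] at hlim
  refine ge_of_tendsto' hlim fun n => le_trans ?_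
    (measure_forall_abs_le_rpow_mul_le hμ (fun i : Fin n => L i) hs ht hst a b)
  gcongr
  exacts [hA a n, hA b n]

lemma measure_ball_rpow_mul_le (hμ : ∀ L : E →L[ℝ] ℝ, ∫ x, L x ∂μ = 0)
    {s t : ℝ} (hs : 0 < s) (ht : 0 < t) (hst : s + t = 1) (a b : ℝ) :
    μ (Metric.ball 0 a) ^ s * μ (Metric.ball 0 b) ^ t ≤ μ (Metric.ball 0 (s * a + t * b)) := by
  have hlim (r : ℝ) : Filter.Tendsto (fun n : ℕ => μ (Metric.closedBall 0 (r - 1 / (n + 1))))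
      Filter.atTop (nhds (μ (Metric.ball 0 r))) := by
    have hmono : Monotone fun n : ℕ => Metric.closedBall (0 : E) (r - 1 / (n + 1)) :=
      fun n m hnm => Metric.closedBall_subset_closedBall
        (sub_le_sub_left (Nat.one_div_le_one_div hnm) _)
    convert! tendsto_measure_iUnion_atTop (μ := μ) hmono
    ext x
    simp only [mem_ball_zero_iff, Set.mem_iUnion, mem_closedBall_zero_iff]
    constructor
    · intro hx
      obtain ⟨n, hn⟩ := exists_nat_one_div_lt (sub_pos.2 hx)
      exact ⟨n, by linarith⟩
    · rintro ⟨n, hn⟩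
      have : (0 : ℝ) < 1 / (n + 1) := Nat.one_div_pos_of_nat
      linarith
  have hfin (r : ℝ) {p : ℝ} (hp : 0 < p) : μ (Metric.ball 0 r) ^ p ≠ ∞ :=
    ENNReal.rpow_ne_top_of_nonneg hp.le (measure_ne_top _ _)
  refine le_of_tendsto' (ENNReal.Tendsto.mul ((hlim a).ennrpow_const s) (.inr (hfin b ht))
    ((hlim b).ennrpow_const t) (.inr (hfin a hs))) fun n =>
    (measure_closedBall_rpow_mul_le hμ hs ht hst _ _).trans
      (measure_mono (Metric.closedBall_subset_ball ?_))
  have : (0 : ℝ) < 1 / (n + 1) := Nat.one_div_pos_of_nat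
  obtain rfl : t = 1 - s := by linarith
  linarith

/-- Balls around the mean of a Gaussian measure are not negligible. -/
lemma measure_ball_pos_of_centered (hμ : ∀ L : E →L[ℝ] ℝ, ∫ x, L x ∂μ = 0) {ε : ℝ} (hε : 0 < ε) :
    0 < μ (Metric.ball 0 ε) := by
  obtain ⟨x, hx⟩ : ∃ x, μ (Metric.ball x (ε / 2)) ≠ 0 := by
    by_contra! h
    have := measure_null_of_locally_null (μ := μ) Set.univ fun x _ =>
      ⟨_, mem_nhdsWithin_of_mem_nhds (Metric.ball_mem_nhds x (half_pos hε)), h x⟩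
    simp at this
  set B := Metric.ball x (ε / 2)
  have hrot := IsGaussian.map_rotation_eq_self_of_forall_strongDual_eq_zero hμ (Real.pi / 4)
  have hB : (μ.prod μ) (B ×ˢ B) ≤ μ (Metric.ball 0 ε) := by
    rw [← hrot, Measure.map_apply (by fun_prop)
      (Metric.isOpen_ball.measurableSet.prod Metric.isOpen_ball.measurableSet)]
    calc _ ≤ (μ.prod μ) (Metric.ball 0 ε ×ˢ Set.univ) := measure_mono ?_
      _ = μ (Metric.ball 0 ε) := by simp
    rintro ⟨u, v⟩ ⟨h1, h2⟩
    simp only [ContinuousLinearMap.rotation_apply, Real.cos_pi_div_four, Real.sin_pi_div_four,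
      Metric.mem_ball] at h1 h2
    refine ⟨mem_ball_zero_iff.2 ?_, trivial⟩
    have h3 := (dist_triangle_right _ _ x).trans_lt (add_lt_add h1 h2)
    rw [dist_eq_norm, add_halves] at h3
    have h4 : (√2 / 2) • u + (√2 / 2) • v - (-(√2 / 2) • u + (√2 / 2) • v) = √2 • u := by
      module
    rw [h4, norm_smul, Real.norm_of_nonneg (Real.sqrt_nonneg 2)] at h3
    exact (le_mul_of_one_le_left (norm_nonneg u) (Real.one_le_sqrt.2 one_le_two)).trans_lt h3
  rw [Measure.prod_prod] at hB
  exact (ENNReal.mul_pos hx hx).trans_le hB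

end Ball

/-- For a centered Gaussian measure on a separable Banach space, the function
`ε ↦ -log μ(B(0,ε))` is convex on `(0,∞)`. -/
theorem gaussian_small_ball_convex
    {E : Type*} [NormedAddCommGroup E] [NormedSpace ℝ E] [CompleteSpace E]
    [TopologicalSpace.SeparableSpace E] [MeasurableSpace E] [BorelSpace E]
    (μ : Measure E) [IsProbabilityMeasure μ]
    (hGauss : ∀ L : E →L[ℝ] ℝ, ∃ (m : ℝ) (v : NNReal), μ.map L = gaussianReal m v)
    (hcentered : ∀ L : E →L[ℝ] ℝ, ∫ x, L x ∂μ = 0) :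
    ConvexOn ℝ (Set.Ioi 0)
      (fun ε => -Real.log (μ (Metric.ball (0 : E) ε)).toReal) := by
  have : SecondCountableTopology E := UniformSpace.secondCountable_of_separable E
  have : IsGaussian μ := isGaussian_of_map_eq_gaussianReal hGauss
  have pos {r : ℝ} (hr : 0 < r) : 0 < (μ (Metric.ball (0 : E) r)).toReal :=
    ENNReal.toReal_pos (measure_ball_pos_of_centered hcentered hr).ne' (measure_ne_top _ _)
  refine convexOn_iff_forall_pos.2 ⟨convex_Ioi 0, fun a ha b hb s t hs ht hst => ?_⟩
  have key := ENNReal.toReal_mono (measure_ne_top _ _)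
    (measure_ball_rpow_mul_le hcentered hs ht hst a b)
  rw [ENNReal.toReal_mul, ← ENNReal.toReal_rpow, ← ENNReal.toReal_rpow] at key
  have hpa := Real.rpow_pos_of_pos (pos ha) s
  have hpb := Real.rpow_pos_of_pos (pos hb) t
  have hlog := Real.log_le_log (mul_pos hpa hpb) key
  rw [Real.log_mul hpa.ne' hpb.ne', Real.log_rpow (pos ha), Real.log_rpow (pos hb)] at hlog
  simp only [smul_eq_mul]
  linarith
end

section
/- Let λ ∈ (0,1] and α ∈ (0,1] be such that α + λ < 2 and α + λ ≠ 1. Let f : ℝ → ℝ be bounded and Hölder of order λ. Then there exists a constant C > 0 (depending only on f, α and λ) such that for every integrable function g : ℝ → ℝ with compact support satisfying ∫ g(u) du = 0 and, in the case α + λ > 1, also ∫ u g(u) du = 0, one has sup_{t ∈ [0,1]} |I^α(f ∗ g)(t)| ≤ C ∫ |u|^{α+λ} |g(u)| du, where (f ∗ g)(s) = ∫ f(s − u) g(u) du. -/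
open MeasureTheory

/-- The (unnormalized) fractional integral of order `γ`:
`I^γ h (t) = ∫₀ᵗ (t - s)^(γ-1) h(s) ds` for `t > 0` and `0` for `t ≤ 0`. -/
noncomputable def fracInt (γ : ℝ) (h : ℝ → ℝ) (t : ℝ) : ℝ :=
  if 0 < t then ∫ s in (0 : ℝ)..t, (t - s) ^ (γ - 1) * h s else 0

/-- Convolution `(f ∗ g)(s) = ∫ f(s - u) g(u) du`. -/
noncomputable def conv (f g : ℝ → ℝ) (s : ℝ) : ℝ := ∫ u, f (s - u) * g u

section Holder

open intervalIntegral

variable {lam α H : ℝ} {m : ℝ → ℝ}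

lemma continuous_of_abs_sub_le_rpow (hlam : 0 < lam)
    (hm : ∀ x y, |m x - m y| ≤ H * |x - y| ^ lam) : Continuous m := by
  refine continuous_iff_continuousAt.2 fun y => ?_
  refine tendsto_iff_dist_tendsto_zero.2 ?_
  have h : Filter.Tendsto (fun x : ℝ => H * |x - y| ^ lam) (nhds y) (nhds 0) := by
    have hc : Continuous fun x : ℝ => H * |x - y| ^ lam :=
      continuous_const.mul ((by fun_prop : Continuous fun x : ℝ => |x - y|).rpow_const
        fun _ => Or.inr hlam.le)
    simpa [Real.zero_rpow hlam.ne'] using hc.tendsto y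
  exact squeeze_zero (fun _ => dist_nonneg) (fun x => by rw [Real.dist_eq]; exact hm x y) h

lemma abs_integral_translate_sub_le (hlam : 0 < lam) (hH : 0 ≤ H)
    (hm : ∀ x y, |m x - m y| ≤ H * |x - y| ^ lam) (u r : ℝ) :
    |(∫ x in r..r + u, m x) - u * m r| ≤ H * |u| ^ lam * |u| := by
  have hc := continuous_of_abs_sub_le_rpow hlam hm
  have e : (∫ x in r..r + u, m x) - u * m r = ∫ x in r..r + u, (m x - m r) := by
    rw [integral_sub (hc.intervalIntegrable _ _) (by simp)]
    simp
  rw [e]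
  have := norm_integral_le_of_norm_le_const (a := r) (b := r + u) (C := H * |u| ^ lam)
    (f := fun x => m x - m r) ?_
  · simpa using this
  · intro x hx
    refine (hm x r).trans ?_
    have : |x - r| ≤ |u| := by
      have := Set.abs_sub_left_of_mem_uIcc (Set.uIoc_subset_uIcc hx)
      simpa using this
    gcongr

lemma hasDerivAt_integral_translate (hc : Continuous m) (u r : ℝ) :
    HasDerivAt (fun r => ∫ x in r..r + u, m x) (m (r + u) - m r) r := by
  have h (y : ℝ) : HasDerivAt (fun y => ∫ x in (0 : ℝ)..y, m x) (m y) y :=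
    integral_hasDerivAt_right (hc.intervalIntegrable _ _)
      hc.aestronglyMeasurable.stronglyMeasurableAtFilter hc.continuousAt
  have h2 := ((h (r + u)).comp_add_const r u).sub (h r)
  refine h2.congr_of_eventuallyEq (Filter.Eventually.of_forall fun y => ?_)
  simp only [Pi.sub_apply]
  rw [integral_interval_sub_left (hc.intervalIntegrable _ _) (hc.intervalIntegrable _ _)]

lemma integral_rpow_mul_translate_sub (hc : Continuous m) (u : ℝ) {ε t : ℝ} (hε : 0 < ε)
    (ht : ε ≤ t) :
    ∫ r in ε..t, r ^ (α - 1) * (m (r + u) - m r) =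
      t ^ (α - 1) * (∫ x in t..t + u, m x) - ε ^ (α - 1) * (∫ x in ε..ε + u, m x)
        + (1 - α) * ∫ r in ε..t, r ^ (α - 2) * ∫ x in r..r + u, m x := by
  have hpos : ∀ x ∈ Set.uIcc ε t, x ≠ 0 := by
    intro x hx
    rw [Set.uIcc_of_le ht] at hx
    exact (hε.trans_le hx.1).ne'
  rw [intervalIntegral.integral_mul_deriv_eq_deriv_mul (u := fun r => r ^ (α - 1))
    (u' := fun r => (α - 1) * r ^ (α - 1 - 1))
    (v := fun r => ∫ x in r..r + u, m x)]
  · simp only [mul_assoc, intervalIntegral.integral_const_mul, show α - 1 - 1 = α - 2 by ring]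
    ring
  · intro x hx
    exact Real.hasDerivAt_rpow_const (Or.inl (hpos x hx))
  · intro x _
    exact hasDerivAt_integral_translate hc u x
  · refine ContinuousOn.intervalIntegrable ?_
    exact continuousOn_const.mul (continuousOn_id.rpow_const fun x hx => Or.inl (hpos x hx))
  · exact Continuous.intervalIntegrable (by fun_prop) _ _

lemma intervalIntegrable_rpow_mul (hα : 0 < α) {k : ℝ → ℝ} (hk : Continuous k) (a b : ℝ) :
    IntervalIntegrable (fun r => r ^ (α - 1) * k r) volume a b :=
  (intervalIntegrable_rpow' (by linarith)).mul_continuousOn hk.continuousOn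

lemma abs_integral_rpow_mul_translate_sub_le (hlam : 0 < lam) (hα : 0 < α) (hH : 0 ≤ H)
    (hm : ∀ x y, |m x - m y| ≤ H * |x - y| ^ lam) {u τ : ℝ} (hτ : 0 ≤ τ) (hτu : τ ≤ |u|) :
    |∫ r in (0 : ℝ)..τ, r ^ (α - 1) * (m (r + u) - m r)| ≤ H / α * |u| ^ (α + lam) := by
  have hb : ‖∫ r in (0 : ℝ)..τ, r ^ (α - 1) * (m (r + u) - m r)‖
      ≤ ∫ r in (0 : ℝ)..τ, r ^ (α - 1) * (H * |u| ^ lam) := by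
    refine norm_integral_le_of_norm_le hτ (Filter.Eventually.of_forall fun r hr => ?_)
      (intervalIntegrable_rpow_mul hα continuous_const _ _)
    rw [Real.norm_eq_abs, abs_mul, abs_of_nonneg (Real.rpow_nonneg hr.1.le _)]
    have := hm (r + u) r
    rw [add_sub_cancel_left] at this
    gcongr
    exact Real.rpow_nonneg hr.1.le _
  rw [intervalIntegral.integral_mul_const, integral_rpow (Or.inl (by linarith)), sub_add_cancel,
    Real.zero_rpow hα.ne', sub_zero] at hb
  refine hb.trans ?_
  rcases (abs_nonneg u).eq_or_lt with h0 | h0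
  · rw [← h0, Real.zero_rpow hlam.ne', Real.zero_rpow (by positivity)]; simp
  rw [Real.rpow_add h0]
  calc τ ^ α / α * (H * |u| ^ lam) ≤ |u| ^ α / α * (H * |u| ^ lam) := by gcongr
    _ = _ := by ring

lemma continuousOn_rpow_of_pos (p : ℝ) {ε t : ℝ} (hε : 0 < ε) (ht : ε ≤ t) :
    ContinuousOn (fun r : ℝ => r ^ p) (Set.uIcc ε t) := by
  refine continuousOn_id.rpow_const fun x hx => Or.inl ?_
  rw [Set.uIcc_of_le ht] at hx
  exact (hε.trans_le hx.1).ne'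

lemma zero_notMem_uIcc_of_pos {ε t : ℝ} (hε : 0 < ε) (ht : ε ≤ t) :
    (0 : ℝ) ∉ Set.uIcc ε t := by
  rw [Set.uIcc_of_le ht]
  exact fun hx => absurd hx.1 (not_le.2 hε)

lemma abs_integral_rpow_mul_translate_sub_le_of_add_lt_one (hlam : 0 < lam) (hα : 0 < α)
    (hs : α + lam < 1) (hH : 0 ≤ H) (h0 : m 0 = 0)
    (hm : ∀ x y, |m x - m y| ≤ H * |x - y| ^ lam) {t : ℝ} (ht : 0 < t) (u : ℝ) :
    |∫ r in (0 : ℝ)..t, r ^ (α - 1) * (m (r + u) - m r)| ≤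
      (H / α + 4 * H + 2 * H / (1 - α - lam)) * |u| ^ (α + lam) := by
  have hc := continuous_of_abs_sub_le_rpow hlam hm
  have hs' : 0 < 1 - α - lam := by linarith
  rcases le_or_gt t |u| with htu | htu
  · refine (abs_integral_rpow_mul_translate_sub_le hlam hα hH hm ht.le htu).trans ?_
    have : 0 ≤ 4 * H + 2 * H / (1 - α - lam) := by positivity
    gcongr
    linarith
  rcases (abs_nonneg u).eq_or_lt with hu | hu
  · have hu : u = 0 := by simpa using hu.symm
    simp [hu, Real.zero_rpow (show α + lam ≠ 0 by positivity)]
  set ε := |u| with hε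
  have hcc : Continuous fun r => m (r + u) - m r := by fun_prop
  rw [← integral_add_adjacent_intervals (b := ε) (intervalIntegrable_rpow_mul hα hcc _ _)
    (intervalIntegrable_rpow_mul hα hcc _ _), integral_rpow_mul_translate_sub hc u hu htu.le]
  have hnear := abs_integral_rpow_mul_translate_sub_le hlam hα hH hm hu.le hε.le
  have hD : ∀ r, ε ≤ r → |∫ x in r..r + u, m x| ≤ 2 * H * ε * r ^ lam := by
    intro r hr
    have h1 := abs_integral_translate_sub_le hlam hH hm u r
    have h2 : |m r| ≤ H * r ^ lam := by
      simpa [h0, abs_of_pos (hu.trans_le hr)] using hm r 0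
    have h3 : |u * m r| ≤ ε * (H * r ^ lam) := by rw [abs_mul]; gcongr
    have h4 : H * ε ^ lam * ε ≤ H * r ^ lam * ε := by gcongr
    have h5 := abs_sub_abs_le_abs_sub (∫ x in r..r + u, m x) (u * m r)
    rw [← hε] at h1
    nlinarith
  have hDw : ∀ r, ε ≤ r → |r ^ (α - 1) * ∫ x in r..r + u, m x| ≤ 2 * H * ε ^ (α + lam) := by
    intro r hr
    have hr0 := hu.trans_le hr
    rw [abs_mul, abs_of_pos (Real.rpow_pos_of_pos hr0 _)]
    calc r ^ (α - 1) * |∫ x in r..r + u, m x| ≤ r ^ (α - 1) * (2 * H * ε * r ^ lam) := by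
          gcongr; exact hD r hr
      _ = 2 * H * ε * r ^ (α - 1 + lam) := by rw [Real.rpow_add hr0]; ring
      _ ≤ 2 * H * ε * ε ^ (α - 1 + lam) := by
          gcongr ?_ * ?_
          exact Real.rpow_le_rpow_of_nonpos hu hr (by linarith)
      _ = 2 * H * ε ^ (α + lam) := by
          rw [show α + lam = α - 1 + lam + 1 by ring, Real.rpow_add_one hu.ne']; ring
  have hI : |(1 - α) * ∫ r in ε..t, r ^ (α - 2) * ∫ x in r..r + u, m x|
      ≤ 2 * H / (1 - α - lam) * ε ^ (α + lam) := by
    have hb : ‖∫ r in ε..t, r ^ (α - 2) * ∫ x in r..r + u, m x‖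
        ≤ ∫ r in ε..t, 2 * H * ε * r ^ (α + lam - 2) := by
      refine norm_integral_le_of_norm_le htu.le (Filter.Eventually.of_forall fun r hr => ?_)
        (ContinuousOn.intervalIntegrable
          (continuousOn_const.mul (continuousOn_rpow_of_pos _ hu htu.le)))
      have hr0 := hu.trans hr.1
      rw [Real.norm_eq_abs, abs_mul, abs_of_pos (Real.rpow_pos_of_pos hr0 _)]
      calc r ^ (α - 2) * |∫ x in r..r + u, m x| ≤ r ^ (α - 2) * (2 * H * ε * r ^ lam) := by
            gcongr; exact hD r hr.1.le
        _ = _ := by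
          rw [show α + lam - 2 = α - 2 + lam by ring, Real.rpow_add hr0]; ring
    rw [intervalIntegral.integral_const_mul, integral_rpow (Or.inr ⟨by linarith,
      zero_notMem_uIcc_of_pos hu htu.le⟩)] at hb
    have h1 : (t ^ (α + lam - 2 + 1) - ε ^ (α + lam - 2 + 1)) / (α + lam - 2 + 1)
        ≤ ε ^ (α + lam - 1) / (1 - α - lam) := by
      rw [← neg_div_neg_eq, show α + lam - 2 + 1 = α + lam - 1 by ring,
        show -(α + lam - 1) = 1 - α - lam by ring]
      gcongr
      have := Real.rpow_nonneg ht.le (α + lam - 1)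
      linarith
    rw [abs_mul, abs_of_pos (show 0 < 1 - α by linarith)]
    rw [Real.norm_eq_abs] at hb
    calc _ ≤ 1 * |∫ r in ε..t, r ^ (α - 2) * ∫ x in r..r + u, m x| := by gcongr; linarith
      _ ≤ 2 * H * ε * (ε ^ (α + lam - 1) / (1 - α - lam)) := by
          rw [one_mul]; refine hb.trans ?_; gcongr
      _ = _ := by
          rw [show α + lam = 1 + (α + lam - 1) by ring, Real.rpow_add hu, Real.rpow_one]
          ring_nf
  have ha := hDw t htu.le
  have hb := hDw ε le_rfl
  rw [abs_le] at *
  constructor <;> linarith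

lemma intervalIntegrable_rpow_mul_of_one_lt (hlam : 0 < lam) (hs : 1 < α + lam) (h0 : m 0 = 0)
    (hm : ∀ x y, |m x - m y| ≤ H * |x - y| ^ lam) {τ : ℝ} (hτ : 0 ≤ τ) :
    IntervalIntegrable (fun r => r ^ (α - 2) * m r) volume 0 τ := by
  have hc := continuous_of_abs_sub_le_rpow hlam hm
  have h : IntervalIntegrable (fun r : ℝ => H * r ^ (α + lam - 2)) volume 0 τ :=
    (intervalIntegrable_rpow' (by linarith)).const_mul _
  refine h.mono_fun' ?_ ?_
  · exact ((by fun_prop : Measurable fun r : ℝ => r ^ (α - 2)).mul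
      hc.measurable).aestronglyMeasurable
  · rw [Set.uIoc_of_le hτ]
    refine (ae_restrict_iff' measurableSet_Ioc).2 (Filter.Eventually.of_forall fun r hr => ?_)
    have h2 : |m r| ≤ H * r ^ lam := by simpa [h0, abs_of_pos hr.1] using hm r 0
    have h3 := Real.rpow_pos_of_pos hr.1 (α - 2)
    beta_reduce
    rw [Real.norm_eq_abs, abs_mul, abs_of_pos h3,
      show α + lam - 2 = α - 2 + lam by ring, Real.rpow_add hr.1]
    nlinarith

lemma abs_deriv_coeff_le (hα0 : 0 < α) (hα : α ≤ 1) (hs : 1 < α + lam)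
    (h0 : m 0 = 0) (hm : ∀ x y, |m x - m y| ≤ H * |x - y| ^ lam) {τ : ℝ}
    (hτ : 0 < τ) :
    |τ ^ (α - 1) * m τ + (1 - α) * ∫ r in (0 : ℝ)..τ, r ^ (α - 2) * m r| ≤
      (H + H / (α + lam - 1)) * τ ^ (α + lam - 1) := by
  have hmr : ∀ r, 0 < r → ∀ p, |r ^ p * m r| ≤ H * r ^ (p + lam) := by
    intro r hr p
    have h2 : |m r| ≤ H * r ^ lam := by simpa [h0, abs_of_pos hr] using hm r 0
    have h3 := Real.rpow_pos_of_pos hr p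
    rw [abs_mul, abs_of_pos h3, Real.rpow_add hr]
    nlinarith
  have h1 := hmr τ hτ (α - 1)
  have hb : ‖∫ r in (0 : ℝ)..τ, r ^ (α - 2) * m r‖
      ≤ ∫ r in (0 : ℝ)..τ, H * r ^ (α - 2 + lam) :=
    norm_integral_le_of_norm_le hτ.le
      (Filter.Eventually.of_forall fun r hr => hmr r hr.1 _)
      ((intervalIntegrable_rpow' (by linarith)).const_mul _)
  rw [intervalIntegral.integral_const_mul, integral_rpow (Or.inl (by linarith)),
    show α - 2 + lam + 1 = α + lam - 1 by ring, Real.zero_rpow (by linarith), sub_zero,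
    Real.norm_eq_abs] at hb
  rw [show α - 1 + lam = α + lam - 1 by ring] at h1
  have h4 : |(1 - α) * ∫ r in (0 : ℝ)..τ, r ^ (α - 2) * m r|
      ≤ H * (τ ^ (α + lam - 1) / (α + lam - 1)) := by
    rw [abs_mul, abs_of_nonneg (by linarith : 0 ≤ 1 - α)]
    refine le_trans ?_ hb
    exact mul_le_of_le_one_left (abs_nonneg _) (by linarith)
  refine (abs_add_le _ _).trans ((add_le_add h1 h4).trans (le_of_eq ?_))
  ring

lemma abs_integral_rpow_mul_translate_sub_sub_le_of_one_lt_add (hlam : 0 < lam) (hα0 : 0 < α)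
    (hα : α ≤ 1) (hs : 1 < α + lam) (hH : 0 ≤ H) (h0 : m 0 = 0)
    (hm : ∀ x y, |m x - m y| ≤ H * |x - y| ^ lam) {t : ℝ} (ht : 0 < t) (u : ℝ) :
    |(∫ r in (0 : ℝ)..t, r ^ (α - 1) * (m (r + u) - m r)) -
        (t ^ (α - 1) * m t + (1 - α) * ∫ r in (0 : ℝ)..t, r ^ (α - 2) * m r) * u| ≤
      (H / α + 4 * H + H / (α + lam - 1)) * |u| ^ (α + lam) := by
  have hc := continuous_of_abs_sub_le_rpow hlam hm
  have hs' : 0 < α + lam - 1 := by linarith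
  rcases (abs_nonneg u).eq_or_lt with hu | hu
  · have hu : u = 0 := by simpa using hu.symm
    simp [hu, Real.zero_rpow (show α + lam ≠ 0 by positivity)]
  set ε := |u| with hε
  have hadd : ε ^ (α + lam) = ε ^ (α + lam - 1) * ε := by
    rw [← Real.rpow_add_one hu.ne']; ring_nf
  have hP : 0 ≤ ε ^ (α + lam) := by positivity
  rcases le_or_gt t ε with htu | htu
  · have h1 := abs_integral_rpow_mul_translate_sub_le hlam hα0 hH hm ht.le htu
    rw [← hε] at h1
    have h2 := abs_deriv_coeff_le hα0 hα hs h0 hm ht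
    have h3 : |(t ^ (α - 1) * m t + (1 - α) * ∫ r in (0 : ℝ)..t, r ^ (α - 2) * m r) * u|
        ≤ (H + H / (α + lam - 1)) * ε ^ (α + lam) := by
      rw [abs_mul, ← hε, hadd, ← mul_assoc]
      gcongr
      refine h2.trans ?_
      gcongr
    refine (abs_sub _ _).trans ((add_le_add h1 h3).trans ?_)
    nlinarith [mul_nonneg hH hP]
  have hcc : Continuous fun r => m (r + u) - m r := by fun_prop
  have hDc : Continuous fun r => ∫ x in r..r + u, m x :=
    continuous_iff_continuousAt.2 fun r => (hasDerivAt_integral_translate hc u r).continuousAt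
  have hw := fun p => continuousOn_rpow_of_pos p hu htu.le
  rw [← integral_add_adjacent_intervals (b := ε) (intervalIntegrable_rpow_mul hα0 hcc _ _)
    (intervalIntegrable_rpow_mul hα0 hcc _ _), integral_rpow_mul_translate_sub hc u hu htu.le]
  have hmi : IntervalIntegrable (fun r => r ^ (α - 2) * m r) volume ε t :=
    ((hw _).mul hc.continuousOn).intervalIntegrable
  rw [← integral_add_adjacent_intervals (b := ε)
    (intervalIntegrable_rpow_mul_of_one_lt hlam hs h0 hm hu.le) hmi]
  have hnear := abs_integral_rpow_mul_translate_sub_le hlam hα0 hH hm hu.le hε.le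
  have hcoef := abs_deriv_coeff_le hα0 hα hs h0 hm hu
  have hE : ∀ r, |(∫ x in r..r + u, m x) - u * m r| ≤ H * ε ^ lam * ε :=
    abs_integral_translate_sub_le hlam hH hm u
  have hεα : H * ε ^ lam * ε * ε ^ (α - 1) = H * ε ^ (α + lam) := by
    rw [show α + lam = lam + 1 + (α - 1) by ring, Real.rpow_add hu, Real.rpow_add_one hu.ne']
    ring
  have hEw : ∀ r, ε ≤ r → |r ^ (α - 1) * ((∫ x in r..r + u, m x) - u * m r)|
      ≤ H * ε ^ (α + lam) := by
    intro r hr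
    have hr0 := hu.trans_le hr
    rw [abs_mul, abs_of_pos (Real.rpow_pos_of_pos hr0 _), ← hεα, mul_comm]
    gcongr ?_ * ?_
    · exact hE r
    · exact Real.rpow_le_rpow_of_nonpos hu hr (by linarith)
  have hI : |(1 - α) * ∫ r in ε..t, r ^ (α - 2) * ((∫ x in r..r + u, m x) - u * m r)|
      ≤ H * ε ^ (α + lam) := by
    rcases hα.eq_or_lt with rfl | hα1
    · simp only [sub_self, zero_mul, abs_zero]; positivity
    have hb : ‖∫ r in ε..t, r ^ (α - 2) * ((∫ x in r..r + u, m x) - u * m r)‖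
        ≤ ∫ r in ε..t, r ^ (α - 2) * (H * ε ^ lam * ε) := by
      refine norm_integral_le_of_norm_le htu.le (Filter.Eventually.of_forall fun r hr => ?_)
        ((hw _).mul continuousOn_const).intervalIntegrable
      have h3 := Real.rpow_pos_of_pos (hu.trans hr.1) (α - 2)
      rw [Real.norm_eq_abs, abs_mul, abs_of_pos h3]
      gcongr
      exact hE r
    rw [intervalIntegral.integral_mul_const, integral_rpow (Or.inr ⟨by linarith,
      zero_notMem_uIcc_of_pos hu htu.le⟩), show α - 2 + 1 = α - 1 by ring,
      Real.norm_eq_abs] at hb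
    rw [abs_mul, abs_of_pos (by linarith : 0 < 1 - α)]
    have hα1' : α - 1 ≠ 0 := by linarith
    calc _ ≤ (1 - α) * ((t ^ (α - 1) - ε ^ (α - 1)) / (α - 1) * (H * ε ^ lam * ε)) :=
          mul_le_mul_of_nonneg_left hb (by linarith)
      _ = H * ε ^ lam * ε * (ε ^ (α - 1) - t ^ (α - 1)) := by field_simp; ring
      _ ≤ H * ε ^ lam * ε * ε ^ (α - 1) := by
          gcongr
          have := Real.rpow_nonneg ht.le (α - 1)
          linarith
      _ = _ := hεα
  have hIsplit : ∫ r in ε..t, r ^ (α - 2) * ((∫ x in r..r + u, m x) - u * m r) =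
      (∫ r in ε..t, r ^ (α - 2) * ∫ x in r..r + u, m x) - u * ∫ r in ε..t, r ^ (α - 2) * m r := by
    rw [← intervalIntegral.integral_const_mul,
      ← integral_sub (f := fun r => r ^ (α - 2) * ∫ x in r..r + u, m x)
        ((hw _).mul hDc.continuousOn).intervalIntegrable (hmi.const_mul u)]
    congr 1
    ext r
    ring
  rw [hIsplit] at hI
  have hcu : |(ε ^ (α - 1) * m ε + (1 - α) * ∫ r in (0 : ℝ)..ε, r ^ (α - 2) * m r) * u|
      ≤ (H + H / (α + lam - 1)) * ε ^ (α + lam) := by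
    rw [abs_mul, ← hε, hadd, ← mul_assoc]
    gcongr
  have ha := hEw t htu.le
  have hb := hEw ε le_rfl
  rw [← hε] at hnear
  clear_value ε
  clear hcoef hE hEw hεα hIsplit hw
  rw [abs_le] at *
  constructor <;> linarith

lemma exists_abs_integral_rpow_mul_sub_le (hlam : lam ∈ Set.Ioc (0 : ℝ) 1)
    (hα : α ∈ Set.Ioc (0 : ℝ) 1) (hne : α + lam ≠ 1) (hH : 0 ≤ H) :
    ∃ C > (0 : ℝ), ∀ h : ℝ → ℝ, (∀ x y, |h x - h y| ≤ H * |x - y| ^ lam) → ∀ t > (0 : ℝ),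
      ∃ c : ℝ, (α + lam < 1 → c = 0) ∧ ∀ u,
        |(∫ r in (0 : ℝ)..t, r ^ (α - 1) * h (r + u)) - (∫ r in (0 : ℝ)..t, r ^ (α - 1) * h r)
          - c * u| ≤ C * |u| ^ (α + lam) := by
  have key (h : ℝ → ℝ) (hm : ∀ x y, |h x - h y| ≤ H * |x - y| ^ lam) (t u : ℝ) :
      (∫ r in (0 : ℝ)..t, r ^ (α - 1) * h (r + u)) - (∫ r in (0 : ℝ)..t, r ^ (α - 1) * h r) =
        ∫ r in (0 : ℝ)..t, r ^ (α - 1) * ((h (r + u) - h 0) - (h r - h 0)) := by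
    have hc := continuous_of_abs_sub_le_rpow hlam.1 hm
    rw [← integral_sub (intervalIntegrable_rpow_mul hα.1 (by fun_prop) _ _)
      (intervalIntegrable_rpow_mul hα.1 hc _ _)]
    congr 1
    ext r
    ring
  rcases hne.lt_or_gt with hs | hs
  · have hs' : 0 < 1 - α - lam := by linarith
    have hα0 := hα.1
    refine ⟨H / α + 4 * H + 2 * H / (1 - α - lam) + 1, by positivity, fun h hm t ht =>
      ⟨0, fun _ => rfl, fun u => ?_⟩⟩
    rw [key h hm, zero_mul, sub_zero]
    refine (abs_integral_rpow_mul_translate_sub_le_of_add_lt_one (m := fun x => h x - h 0)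
      hlam.1 hα.1 hs hH (sub_self _) (fun x y => by simpa using hm x y) ht u).trans ?_
    exact mul_le_mul_of_nonneg_right (le_add_of_nonneg_right zero_le_one) (by positivity)
  · have hs' : 0 < α + lam - 1 := by linarith
    have hα0 := hα.1
    refine ⟨H / α + 4 * H + H / (α + lam - 1) + 1, by positivity, fun h hm t ht =>
      ⟨t ^ (α - 1) * (h t - h 0) + (1 - α) * ∫ r in (0 : ℝ)..t, r ^ (α - 2) * (h r - h 0),
        fun hlt => absurd hlt hs.not_gt, fun u => ?_⟩⟩
    rw [key h hm]
    refine (abs_integral_rpow_mul_translate_sub_sub_le_of_one_lt_add (m := fun x => h x - h 0)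
      hlam.1 hα.1 hα.2 hs hH (sub_self _) (fun x y => by simpa using hm x y) ht u).trans ?_
    exact mul_le_mul_of_nonneg_right (le_add_of_nonneg_right zero_le_one) (by positivity)

end Holder

lemma Continuous.integrable_mul_of_hasCompactSupport {k g : ℝ → ℝ} (hk : Continuous k)
    (hg : Integrable g) (hs : HasCompactSupport g) : Integrable fun u => k u * g u := by
  have h : IntegrableOn (fun u => k u * g u) (tsupport g) :=
    hg.integrableOn.continuousOn_mul hk.continuousOn hs
  refine (integrableOn_iff_integrable_of_support_subset ?_).1 h
  exact (Function.support_mul_subset_right k g).trans (subset_tsupport g)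

lemma fracInt_conv_eq {α : ℝ} (hα : 0 < α) {f g : ℝ → ℝ} (hf : Continuous f) {Mf : ℝ}
    (hfb : ∀ x, |f x| ≤ Mf) (hg : Integrable g) {t : ℝ} (ht : 0 < t) :
    Integrable (fun u => (∫ r in (0 : ℝ)..t, r ^ (α - 1) * f (t - (r + u))) * g u) ∧
      fracInt α (conv f g) t =
        ∫ u, (∫ r in (0 : ℝ)..t, r ^ (α - 1) * f (t - (r + u))) * g u := by
  have hw : Integrable (fun r : ℝ => r ^ (α - 1)) (volume.restrict (Set.Ioc 0 t)) :=
    (intervalIntegrable_iff_integrableOn_Ioc_of_le ht.le).1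
      (intervalIntegral.intervalIntegrable_rpow' (by linarith))
  have hint : Integrable (fun p : ℝ × ℝ => f (t - (p.1 + p.2)) * (p.1 ^ (α - 1) * g p.2))
      ((volume.restrict (Set.Ioc 0 t)).prod volume) := by
    refine (hw.mul_prod hg).bdd_mul (c := Mf) ?_ ?_
    · exact (by fun_prop : Continuous fun p : ℝ × ℝ => f (t - (p.1 + p.2))).aestronglyMeasurable
    · exact Filter.Eventually.of_forall fun p => hfb _
  have e (u : ℝ) : ∫ r in Set.Ioc 0 t, f (t - (r + u)) * (r ^ (α - 1) * g u) =
      (∫ r in (0 : ℝ)..t, r ^ (α - 1) * f (t - (r + u))) * g u := by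
    rw [intervalIntegral.integral_of_le ht.le, ← MeasureTheory.integral_mul_const]
    congr 1
    ext r
    ring
  refine ⟨?_, ?_⟩
  · have := hint.integral_prod_right
    simpa only [e] using this
  · rw [fracInt, if_pos ht]
    have h1 := intervalIntegral.integral_comp_sub_left (a := 0) (b := t)
      (fun s => (t - s) ^ (α - 1) * conv f g s) t
    rw [sub_self, sub_zero] at h1
    rw [← h1, intervalIntegral.integral_of_le ht.le]
    have h2 := integral_integral_swap (f := fun r u => f (t - (r + u)) * (r ^ (α - 1) * g u)) hint
    simp only [e] at h2
    rw [← h2]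
    congr 1
    ext r
    rw [conv, ← MeasureTheory.integral_const_mul]
    congr 1
    ext u
    rw [sub_sub_cancel, sub_sub]
    ring

/-- Lemma 5.2 in van der Vaart–van Zanten: for `λ, α ∈ (0,1]` with `α + λ < 2` and
`α + λ ≠ 1`, a bounded `λ`-Hölder `f` and a compactly supported integrable `g` with
vanishing mean (and vanishing first moment when `α + λ > 1`),
`‖I^α(f ∗ g)‖_∞ ≲ ∫ |u|^{α+λ} |g(u)| du` on `[0,1]`. -/
theorem fracInt_conv_bound
    (lam α : ℝ) (hlam : lam ∈ Set.Ioc (0 : ℝ) 1) (hα : α ∈ Set.Ioc (0 : ℝ) 1)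
    (hsum : α + lam < 2) (hne : α + lam ≠ 1)
    (f : ℝ → ℝ) (Mf : ℝ) (hfb : ∀ x, |f x| ≤ Mf)
    (H : ℝ) (hH : ∀ x y, |f x - f y| ≤ H * |x - y| ^ lam) :
    ∃ C > (0 : ℝ), ∀ g : ℝ → ℝ, Integrable g → HasCompactSupport g →
      (∫ u, g u) = 0 → ((1 : ℝ) < α + lam → (∫ u, u * g u) = 0) →
      ∀ t ∈ Set.Icc (0 : ℝ) 1,
        |fracInt α (conv f g) t| ≤ C * ∫ u, |u| ^ (α + lam) * |g u| := by
  have hH0 : 0 ≤ H := by simpa using (abs_nonneg _).trans (hH 1 0)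
  obtain ⟨C, hC, hbound⟩ := exists_abs_integral_rpow_mul_sub_le hlam hα hne hH0
  refine ⟨C, hC, fun g hg hs hg0 hg1 t ht => ?_⟩
  have hp : 0 < α + lam := add_pos hα.1 hlam.1
  rcases ht.1.eq_or_lt with rfl | ht0
  · simp only [fracInt, lt_irrefl, if_false, abs_zero]
    have : 0 ≤ ∫ u, |u| ^ (α + lam) * |g u| := integral_nonneg fun u => by positivity
    positivity
  obtain ⟨hint, heq⟩ :=
    fracInt_conv_eq hα.1 (continuous_of_abs_sub_le_rpow hlam.1 hH) hfb hg ht0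
  obtain ⟨c, hc, hcb⟩ := hbound (fun x => f (t - x)) (fun x y => by
    have := hH (t - x) (t - y)
    rwa [sub_sub_sub_cancel_left, abs_sub_comm y x] at this) t ht0
  have hug : Integrable fun u => u * g u :=
    continuous_id.integrable_mul_of_hasCompactSupport hg hs
  have hcug : c * ∫ u, u * g u = 0 := by
    rcases hne.lt_or_gt with h | h
    · rw [hc h, zero_mul]
    · rw [hg1 h, mul_zero]
  set F : ℝ → ℝ := fun u => ∫ r in (0 : ℝ)..t, r ^ (α - 1) * f (t - (r + u)) with hF
  set F₀ : ℝ := ∫ r in (0 : ℝ)..t, r ^ (α - 1) * f (t - r)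
  have heq' : fracInt α (conv f g) t = ∫ u, (F u - F₀ - c * u) * g u := by
    have e : (fun u => (F u - F₀ - c * u) * g u)
        = fun u => F u * g u - F₀ * g u - c * (u * g u) := by ext u; ring
    have hFg : Integrable fun u => F u * g u - F₀ * g u := hint.sub (hg.const_mul _)
    rw [e, MeasureTheory.integral_sub hFg (hug.const_mul _),
      MeasureTheory.integral_sub hint (hg.const_mul _), MeasureTheory.integral_const_mul,
      MeasureTheory.integral_const_mul, hcug, hg0, heq]
    simp
  rw [heq', ← MeasureTheory.integral_const_mul]
  have hk : Continuous fun u : ℝ => |u| ^ (α + lam) :=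
    continuous_abs.rpow_const fun _ => Or.inr hp.le
  refine norm_integral_le_of_norm_le (f := fun u => (F u - F₀ - c * u) * g u)
    ((hk.integrable_mul_of_hasCompactSupport hg.norm hs.norm).const_mul C)
    (Filter.Eventually.of_forall fun u => ?_)
  rw [norm_mul, Real.norm_eq_abs, Real.norm_eq_abs, ← mul_assoc]
  exact mul_le_mul_of_nonneg_right (hcb u) (abs_nonneg _)
end
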